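/- arXiv:1810.09887 — 2 statements merged into one kernel-verified Lean document; each statement's English description precedes it below -/
import Mathlib

section
/- The number of 321-avoiding permutations of size N that are (N-3)-winnable equals S_3(N) = 3·C_{N-1} - 4·C_{N-2} - C_{N-3}, and similarly S_2(N) = 2·C_{N-1} - C_{N-2}, S_4(N) = 4·C_{N-1} - 9·C_{N-2} - C_{N-4}, and S_5(N) = 5·C_{N-1} - 16·C_{N-2} + 6·C_{N-3} - C_{N-5}. -/
def IsLTRMax {N : ℕ} (p : Equiv.Perm (Fin N)) (j : Fin N) : Prop :=
  ∀ i : Fin N, i < j → p i < p j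

def Winnable (N k : ℕ) (p : Equiv.Perm (Fin N)) : Prop :=
  ∃ j : Fin N, k ≤ (j : ℕ) ∧ IsLTRMax p j ∧
    (∀ i : Fin N, k ≤ (i : ℕ) → IsLTRMax p i → j ≤ i) ∧ ((p j : ℕ) = N - 1)

def Avoids321 {N : ℕ} (p : Equiv.Perm (Fin N)) : Prop :=
  ¬ ∃ i j l : Fin N, i < j ∧ j < l ∧ p l < p j ∧ p j < p i

/-- `S_i(N)`: the number of 321-avoiding permutations of size `N` that are
`(N-i)`-winnable. -/
noncomputable def S (i N : ℕ) : ℕ :=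
  Nat.card {p : Equiv.Perm (Fin N) // Avoids321 p ∧ Winnable N (N - i) p}

open Finset

/-- The running maximum of `p`, shifted by one: the supremum of `p y + 1` over `y < x`. -/
def runMax (p : ℕ → ℕ) : ℕ → ℕ
  | 0 => 0
  | x + 1 => max (runMax p x) (p x + 1)

theorem runMax_mono (p : ℕ → ℕ) : Monotone (runMax p) :=
  monotone_nat_of_le_succ fun _ => le_max_left _ _

theorem lt_runMax (p : ℕ → ℕ) {y x : ℕ} (h : y < x) : p y < runMax p x :=
  (le_max_right (runMax p y) (p y + 1)).trans (runMax_mono p h)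

theorem runMax_le (p : ℕ → ℕ) {x b : ℕ} (h : ∀ y < x, p y < b) : runMax p x ≤ b := by
  induction x with
  | zero => exact Nat.zero_le _
  | succ x ih => exact max_le (ih fun y hy => h y (by omega)) (h x (by omega))

theorem exists_eq_runMax (p : ℕ → ℕ) {x v : ℕ} (h : v < runMax p x) : ∃ y < x, v ≤ p y := by
  by_contra! hc
  exact absurd (runMax_le p hc) (by omega)

/-- A permutation of `Fin N` as a function on the natural numbers. -/
def permVal {N : ℕ} (p : Equiv.Perm (Fin N)) (y : ℕ) : ℕ :=
  if hy : y < N then (p ⟨y, hy⟩ : ℕ) else 0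

@[simp] theorem permVal_coe {N : ℕ} (p : Equiv.Perm (Fin N)) (y : Fin N) :
    permVal p y = p y := by
  simp [permVal]

theorem permVal_lt {N : ℕ} (p : Equiv.Perm (Fin N)) {y : ℕ} (hy : y < N) : permVal p y < N := by
  simp [permVal, hy]

theorem permVal_inj {N : ℕ} (p : Equiv.Perm (Fin N)) {x y : ℕ} (hx : x < N) (hy : y < N)
    (h : permVal p x = permVal p y) : x = y := by
  simpa [permVal, hx, hy, Fin.val_inj] using h

theorem exists_permVal_eq {N : ℕ} (p : Equiv.Perm (Fin N)) {v : ℕ} (hv : v < N) :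
    ∃ x < N, permVal p x = v :=
  ⟨p.symm ⟨v, hv⟩, Fin.is_lt _, by simp⟩

theorem Avoids321.not_permVal {N : ℕ} {p : Equiv.Perm (Fin N)} (hp : Avoids321 p) {x y z : ℕ}
    (hxy : x < y) (hyz : y < z) (hz : z < N) (h₁ : permVal p z < permVal p y)
    (h₂ : permVal p y < permVal p x) : False := by
  refine hp ⟨⟨x, by omega⟩, ⟨y, by omega⟩, ⟨z, hz⟩, hxy, hyz, ?_, ?_⟩
  · simpa [permVal, hz, hyz.trans hz] using h₁
  · simpa [permVal, hyz.trans hz, (hxy.trans hyz).trans hz] using h₂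

theorem isLTRMax_iff {N : ℕ} (p : Equiv.Perm (Fin N)) (j : Fin N) :
    IsLTRMax p j ↔ runMax (permVal p) j ≤ permVal p j := by
  constructor
  · intro h
    refine runMax_le _ fun y hy => ?_
    have := h ⟨y, hy.trans j.is_lt⟩ hy
    rw [permVal_coe]
    simpa [permVal, hy.trans j.is_lt] using this
  · intro h i hij
    have := (lt_runMax (permVal p) (show (i : ℕ) < j from hij)).trans_le h
    simpa using this

theorem runMax_permVal_top {N : ℕ} (p : Equiv.Perm (Fin N)) {x m : ℕ} (hx : x ≤ N) (hm : m < x)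
    (h : permVal p m = N - 1) : runMax (permVal p) x = N := by
  apply le_antisymm
  · exact runMax_le _ fun y hy => permVal_lt p (by omega)
  · have := lt_runMax (permVal p) hm
    omega

theorem le_runMax_permVal {N : ℕ} (p : Equiv.Perm (Fin N)) {x : ℕ} (hx : x ≤ N) :
    x ≤ runMax (permVal p) x := by
  have h := card_le_card_of_injOn (s := range x) (t := range (runMax (permVal p) x)) (permVal p)
    (fun y hy => by
      simp only [coe_range, Set.mem_Iio] at hy ⊢
      exact lt_runMax _ hy)
    (fun y hy z hz hyz => by
      simp only [coe_range, Set.mem_Iio] at hy hz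
      exact permVal_inj p (by omega) (by omega) hyz)
  simpa using h

theorem runMax_permVal_lt {N : ℕ} (p : Equiv.Perm (Fin N)) {x m : ℕ} (hm : m < N) (hx : x ≤ m)
    (h : permVal p m = N - 1) : runMax (permVal p) x ≤ N - 1 := by
  refine runMax_le _ fun y hy => ?_
  have h₁ := permVal_lt p (show y < N by omega)
  have h₂ : permVal p y ≠ N - 1 := fun hc => by
    have := permVal_inj p (by omega) hm (hc.trans h.symm)
    omega
  omega

/-- A permutation is `k`-winnable iff its maximum sits at some position `m ≥ k` and no running
maximum is attained in positions `k, …, m - 1`. -/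
theorem winnable_iff {N k : ℕ} (p : Equiv.Perm (Fin N)) {m : ℕ} (hm : m < N)
    (hmax : permVal p m = N - 1) :
    Winnable N k p ↔ k ≤ m ∧ runMax (permVal p) m = runMax (permVal p) k := by
  constructor
  · rintro ⟨j, hkj, -, hmin, hj⟩
    obtain rfl : (j : ℕ) = m := permVal_inj p j.is_lt hm (by rw [permVal_coe, hj, hmax])
    refine ⟨hkj, ?_⟩
    have key : ∀ x, k ≤ x → x ≤ j → runMax (permVal p) x = runMax (permVal p) k := by
      intro x hx
      induction x, hx using Nat.le_induction with
      | base => exact fun _ => rfl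
      | succ x hx ih =>
        intro hxj
        rw [← ih (by omega)]
        refine max_eq_left ?_
        by_contra! hc
        have := hmin ⟨x, by omega⟩ hx ((isLTRMax_iff p _).2 (by simpa using Nat.lt_succ_iff.1 hc))
        rw [Fin.le_def] at this
        simp only at this
        omega
    exact key j hkj le_rfl
  · rintro ⟨hkm, he⟩
    refine ⟨⟨m, hm⟩, hkm, (isLTRMax_iff p _).2 ?_, ?_, by simpa [permVal, hm] using hmax⟩
    · simpa [hmax] using runMax_permVal_lt p hm le_rfl hmax
    · intro i hki hi
      rw [isLTRMax_iff] at hi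
      rw [Fin.le_def]
      by_contra! hc
      have h₁ := lt_runMax (permVal p) hc
      have h₂ := runMax_mono (permVal p) hki
      simp only at h₁
      omega

theorem eq_of_runMax_eq {N : ℕ} {p q : Equiv.Perm (Fin N)} (hp : Avoids321 p) (hq : Avoids321 q)
    (h : ∀ x ≤ N, runMax (permVal p) x = runMax (permVal q) x) : p = q := by
  have not_lt : ∀ p q : Equiv.Perm (Fin N), Avoids321 q →
      (∀ x ≤ N, runMax (permVal p) x = runMax (permVal q) x) → ∀ x < N,
      (∀ y < x, permVal p y = permVal q y) → ¬ permVal p x < permVal q x := by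
    intro p q hq h x hx ih hlt
    obtain ⟨z, hz, hzx⟩ := exists_permVal_eq q (permVal_lt p hx)
    have hxz : x < z := by
      rcases lt_trichotomy z x with hc | rfl | hc
      · rw [← ih z hc] at hzx
        have := permVal_inj p hz hx hzx
        omega
      · omega
      · exact hc
    have h₁ : permVal q x < runMax (permVal q) x := by
      have h₂ := h (x + 1) hx
      have h₃ := h x hx.le
      simp only [runMax] at h₂
      omega
    obtain ⟨y, hy, hyx⟩ := exists_eq_runMax _ h₁
    have hne : permVal q x ≠ permVal q y := fun hc => by
      have := permVal_inj q hx (by omega) hc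
      omega
    exact hq.not_permVal hy hxz hz (by omega) (by omega)
  have key : ∀ x < N, permVal p x = permVal q x := by
    intro x
    induction x using Nat.strong_induction_on with
    | _ x ih =>
      intro hx
      have ih' : ∀ y < x, permVal p y = permVal q y := fun y hy => ih y hy (hy.trans hx)
      exact le_antisymm
        (le_of_not_gt <| not_lt q p hp (fun x hx => (h x hx).symm) x hx
          fun y hy => (ih' y hy).symm)
        (le_of_not_gt <| not_lt p q hq h x hx ih')
  ext x
  simpa using key x x.is_lt

/-- The value chosen at position `x`, given the set `s` of used values, by the greedy
reconstruction of a 321-avoiding permutation with running maximum `h`. -/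
noncomputable def greedyVal (h : ℕ → ℕ) (s : Finset ℕ) (x : ℕ) : ℕ :=
  if h x < h (x + 1) then h (x + 1) - 1 else sInf {v | v ∉ s}

/-- The values used before position `x` by the greedy reconstruction. -/
noncomputable def greedyUsed (h : ℕ → ℕ) : ℕ → Finset ℕ
  | 0 => ∅
  | x + 1 => insert (greedyVal h (greedyUsed h x) x) (greedyUsed h x)

/-- The 321-avoiding sequence with running maximum `h`. -/
noncomputable def greedy (h : ℕ → ℕ) (x : ℕ) : ℕ :=
  greedyVal h (greedyUsed h x) x

theorem mem_greedyUsed {h : ℕ → ℕ} {x v : ℕ} :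
    v ∈ greedyUsed h x ↔ ∃ y < x, greedy h y = v := by
  induction x with
  | zero => simp [greedyUsed]
  | succ x ih =>
    rw [greedyUsed, mem_insert, ih, Nat.exists_lt_succ_right, or_comm]
    exact or_congr_right eq_comm

theorem greedy_spec {h : ℕ → ℕ} {s : Finset ℕ} {x : ℕ} (hmono : h x ≤ h (x + 1))
    (hx : x + 1 ≤ h (x + 1)) (hs : s ⊆ range (h x)) (hcard : s.card ≤ x) :
    greedyVal h s x ∉ s ∧ greedyVal h s x < h (x + 1) := by
  unfold greedyVal
  split_ifs with hlt
  · refine ⟨fun hc => ?_, by omega⟩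
    have := mem_range.1 (hs hc)
    omega
  · obtain ⟨v, hv, hvs⟩ : ∃ v ∈ range (h (x + 1)), v ∉ s :=
      exists_mem_notMem_of_card_lt_card (by rw [card_range]; omega)
    exact ⟨Nat.sInf_mem (s := {v | v ∉ s}) ⟨v, hvs⟩,
      (Nat.sInf_le (s := {v | v ∉ s}) hvs).trans_lt (mem_range.1 hv)⟩

theorem greedyUsed_bounds {h : ℕ → ℕ} {N : ℕ} (hmono : Monotone h) (hle : ∀ x ≤ N, x ≤ h x)
    {x : ℕ} (hx : x ≤ N) : greedyUsed h x ⊆ range (h x) ∧ (greedyUsed h x).card ≤ x := by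
  induction x with
  | zero => simp [greedyUsed]
  | succ x ih =>
    obtain ⟨hs, hcard⟩ := ih (by omega)
    have hstep := hmono (Nat.le_add_right x 1)
    refine ⟨insert_subset (mem_range.2 (greedy_spec hstep (hle _ hx) hs hcard).2)
      (hs.trans (range_mono hstep)), (card_insert_le _ _).trans (by omega)⟩

theorem greedy_notMem_and_lt {h : ℕ → ℕ} {N : ℕ} (hmono : Monotone h) (hle : ∀ x ≤ N, x ≤ h x)
    {x : ℕ} (hx : x < N) : greedy h x ∉ greedyUsed h x ∧ greedy h x < h (x + 1) :=
  have hb := greedyUsed_bounds hmono hle hx.le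
  greedy_spec (hmono (Nat.le_add_right x 1)) (hle _ hx) hb.1 hb.2

/-- Every monotone `h` with `h 0 = 0`, `x ≤ h x` and `h N = N` is the running maximum of a
321-avoiding permutation. -/
theorem exists_perm_runMax_eq {h : ℕ → ℕ} {N : ℕ} (hmono : Monotone h) (h0 : h 0 = 0)
    (hle : ∀ x ≤ N, x ≤ h x) (hN : h N = N) :
    ∃ p : Equiv.Perm (Fin N), Avoids321 p ∧ ∀ x ≤ N, runMax (permVal p) x = h x := by
  have spec := fun {x : ℕ} => greedy_notMem_and_lt hmono hle (x := x)
  let f : Fin N → Fin N := fun x => ⟨greedy h x, (spec x.is_lt).2.trans_le (by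
    have := hmono (show (x : ℕ) + 1 ≤ N from x.is_lt)
    omega)⟩
  have hne : ∀ x y : Fin N, x < y → f x ≠ f y := fun x y hxy hc =>
    (spec y.is_lt).1 (mem_greedyUsed.2 ⟨x, hxy, congrArg Fin.val hc⟩)
  have hinj : Function.Injective f := by
    intro x y hxy
    rcases lt_trichotomy x y with hlt | heq | hlt
    · exact absurd hxy (hne x y hlt)
    · exact heq
    · exact absurd hxy.symm (hne y x hlt)
  let p := Equiv.ofBijective f (Finite.injective_iff_bijective.1 hinj)
  have hp : ∀ x, x < N → permVal p x = greedy h x := fun x hx => by simp [permVal, hx, p, f]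
  have hrun : ∀ x ≤ N, runMax (permVal p) x = h x := by
    intro x
    induction x with
    | zero => exact fun _ => h0.symm
    | succ x ih =>
      intro hx
      have h₁ := (spec hx).2
      have h₂ := hmono (Nat.le_add_right x 1)
      rw [runMax, ih (by omega), hp x hx]
      by_cases hlt : h x < h (x + 1)
      · have : greedy h x = h (x + 1) - 1 := if_pos hlt
        omega
      · omega
  refine ⟨p, ?_, hrun⟩
  rintro ⟨x, y, z, hxy, hyz, hzy, hyx⟩
  have hnot : ¬ h y < h (y + 1) := fun hlt => by
    have h₁ : greedy h y = h (y + 1) - 1 := if_pos hlt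
    have h₂ := hmono (show (x : ℕ) + 1 ≤ y from hxy)
    have h₃ := (spec x.is_lt).2
    have h₄ : greedy h y < greedy h x := hyx
    omega
  have hy : greedy h y = sInf {v | v ∉ greedyUsed h y} := if_neg hnot
  have hz : greedy h z ∉ greedyUsed h y := fun hc => by
    obtain ⟨w, hw, hwz⟩ := mem_greedyUsed.1 hc
    exact (spec z.is_lt).1 (mem_greedyUsed.2 ⟨w, hw.trans hyz, hwz⟩)
  have h₁ := Nat.sInf_le (s := {v | v ∉ greedyUsed h y}) hz
  have h₂ : greedy h z < greedy h y := hzy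
  omega

open Classical in
/-- Monotone functions `h` with `h 0 = 0` and `x ≤ h x` for `x ≤ k` that are constantly `v`
from `k` on: partial Dyck paths, given by the heights of their columns. -/
noncomputable def paths : ℕ → ℕ → Finset (ℕ → ℕ)
  | 0, v => if v = 0 then {fun _ => 0} else ∅
  | k + 1, v =>
    if k + 1 ≤ v then
      (range (v + 1)).biUnion fun w => (paths k w).image fun h x => if x ≤ k then h x else v
    else ∅

theorem mem_paths {k v : ℕ} {h : ℕ → ℕ} :
    h ∈ paths k v ↔ h 0 = 0 ∧ Monotone h ∧ (∀ x ≤ k, x ≤ h x) ∧ ∀ x, k ≤ x → h x = v := by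
  induction k generalizing v h with
  | zero =>
    constructor
    · intro hh
      rw [paths] at hh
      split_ifs at hh with hv
      · rw [mem_singleton] at hh
        subst hh
        exact ⟨rfl, monotone_const, fun x hx => hx, fun _ _ => hv.symm⟩
      · simp at hh
    · rintro ⟨h0, -, -, hc⟩
      have hv : v = 0 := (hc 0 le_rfl).symm.trans h0
      rw [paths, if_pos hv, mem_singleton]
      exact funext fun x => (hc x (Nat.zero_le x)).trans hv
  | succ k ih =>
    constructor
    · intro hh
      rw [paths] at hh
      split_ifs at hh with hv
      · simp only [mem_biUnion, mem_range, mem_image] at hh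
        obtain ⟨w, hw, g, hg, rfl⟩ := hh
        obtain ⟨h0, hm, hle, hc⟩ := ih.1 hg
        have hk := hc k le_rfl
        refine ⟨by simp [h0], fun x y hxy => ?_, fun x hx => ?_, fun x hx => ?_⟩
        · have h₁ := hm hxy
          rcases le_or_gt y k with hy | hy
          · simp [hy, hxy.trans hy, h₁]
          · rcases le_or_gt x k with hx | hx
            · have h₂ := hm hx
              simp only [hx, hy.not_ge, if_true, if_false]
              omega
            · simp [hx.not_ge, hy.not_ge]
        · dsimp only
          split_ifs with hxk
          · exact hle x hxk
          · omega
        · exact if_neg (by omega)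
      · simp at hh
    · rintro ⟨h0, hm, hle, hc⟩
      have hv := hc (k + 1) le_rfl
      have hk := hm (Nat.le_add_right k 1)
      have hv' := hle (k + 1) le_rfl
      rw [paths, if_pos (by omega)]
      simp only [mem_biUnion, mem_range, mem_image]
      refine ⟨h k, by omega, fun x => h (min x k), ih.2 ⟨by simpa using h0,
        fun x y hxy => hm (min_le_min_right k hxy), fun x hx => ?_, fun x hx => ?_⟩, ?_⟩
      · rw [min_eq_left hx]
        exact hle x (by omega)
      · rw [min_eq_right hx]
      · funext x
        dsimp only
        split_ifs with hx
        · rw [min_eq_left hx]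
        · exact (hc x (by omega)).symm

theorem paths_apply {k v : ℕ} {h : ℕ → ℕ} (hh : h ∈ paths k v) {x : ℕ} (hx : k ≤ x) : h x = v :=
  (mem_paths.1 hh).2.2.2 x hx

theorem paths_eq_empty {k v : ℕ} (hv : v < k) : paths k v = ∅ := by
  refine eq_empty_of_forall_notMem fun h hh => ?_
  have := (mem_paths.1 hh).2.2.1 k le_rfl
  have := paths_apply hh le_rfl
  omega

theorem card_paths_succ {k v : ℕ} (hv : k + 1 ≤ v) :
    (paths (k + 1) v).card = ∑ w ∈ range (v + 1), (paths k w).card := by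
  classical
  have agree : ∀ {g g' : ℕ → ℕ}, (fun x => if x ≤ k then g x else v) =
      (fun x => if x ≤ k then g' x else v) → ∀ x ≤ k, g x = g' x := by
    intro g g' h x hx
    simpa [hx] using congrFun h x
  rw [paths, if_pos hv, card_biUnion]
  · refine sum_congr rfl fun w _ => card_image_of_injOn fun g hg g' hg' h => funext fun x => ?_
    rcases le_or_gt x k with hx | hx
    · exact agree h x hx
    · rw [paths_apply hg hx.le, paths_apply hg' hx.le]
  · intro w _ w' _ hne
    rw [Function.onFun_apply, disjoint_left]
    intro f hf hf'
    obtain ⟨g, hg, rfl⟩ := mem_image.1 hf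
    obtain ⟨g', hg', h⟩ := mem_image.1 hf'
    apply hne
    rw [← paths_apply hg le_rfl, ← paths_apply hg' le_rfl, agree h k le_rfl]

theorem card_paths_succ_self (k : ℕ) :
    (paths (k + 1) (k + 1)).card = (paths k k).card + (paths k (k + 1)).card := by
  rw [card_paths_succ le_rfl, sum_range_succ, sum_range_succ, sum_eq_zero, zero_add]
  intro w hw
  rw [paths_eq_empty (mem_range.1 hw), card_empty]

theorem card_paths_succ_succ (k u : ℕ) :
    (paths (k + 1) (k + u + 2)).card =
      (paths (k + 1) (k + u + 1)).card + (paths k (k + u + 2)).card := by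
  rw [card_paths_succ (by omega), sum_range_succ, ← card_paths_succ (by omega)]

/-- The ballot numbers. -/
theorem card_paths_add_choose (k u : ℕ) :
    (paths (k + 1) (k + 1 + u)).card + (2 * k + u + 1).choose (k + u + 2) =
      (2 * k + u + 1).choose (k + u + 1) := by
  induction k generalizing u with
  | zero =>
    rw [card_paths_succ (by omega), sum_eq_single_of_mem 0 (by simp)]
    · simp [paths]
    · intro w _ hw
      simp [paths, hw]
  | succ k ihk =>
    induction u with
    | zero =>
      have h₀ := ihk 0
      have h₁ := ihk 1
      have h₂ := card_paths_succ_self (k + 1)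
      have e₁ := Nat.choose_succ_succ' (2 * k + 2) (k + 1)
      have e₂ := Nat.choose_succ_succ' (2 * k + 2) (k + 2)
      have e₃ := Nat.choose_succ_succ' (2 * k + 1) k
      have e₄ := Nat.choose_succ_succ' (2 * k + 1) (k + 1)
      have e₅ := Nat.choose_symm_half k
      simp only [add_zero, mul_add, mul_one, add_assoc, Nat.reduceAdd] at *
      omega
    | succ u ihu =>
      have h₀ := ihk (u + 2)
      have h₂ := card_paths_succ_succ (k + 1) u
      have e₁ := Nat.choose_succ_succ' (2 * k + u + 3) (k + u + 2)
      have e₂ := Nat.choose_succ_succ' (2 * k + u + 3) (k + u + 3)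
      ring_nf at *
      omega

theorem card_paths_self (k : ℕ) : (paths k k).card = catalan k := by
  cases k with
  | zero => simp [paths]
  | succ k =>
    have h := card_paths_add_choose k 0
    have e₂ := Nat.choose_succ_right_eq (2 * k + 1) (k + 1)
    have e₃ := Nat.choose_symm_half k
    have e₄ := succ_mul_catalan_eq_centralBinom (k + 1)
    have e₅ := Nat.choose_succ_succ' (2 * k + 1) k
    rw [Nat.centralBinom, show 2 * (k + 1) = 2 * k + 1 + 1 by ring] at e₄
    rw [show 2 * k + 1 - (k + 1) = k by omega] at e₂
    simp only [add_zero] at h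
    rw [e₅, ← e₃] at e₄
    have h' := congrArg (· * (k + 2)) h
    apply Nat.eq_of_mul_eq_mul_left (show 0 < k + 2 by omega)
    linarith

/-- Winnable 321-avoiding permutations of size `N` correspond to a partial Dyck path ending at
some height `v < N` together with the position `m ∈ [k, v]` of the maximum. -/
theorem card_winnable {N k : ℕ} (hk : k < N) :
    Nat.card {p : Equiv.Perm (Fin N) // Avoids321 p ∧ Winnable N k p} =
      ∑ v ∈ Ico k N, (paths k v).card * (v + 1 - k) := by
  classical
  let Q := (Ico k N).biUnion fun v => paths k v ×ˢ Icc k v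
  have hQ : Q.card = ∑ v ∈ Ico k N, (paths k v).card * (v + 1 - k) := by
    rw [card_biUnion]
    · simp
    · intro v _ w _ hne
      rw [Function.onFun_apply, disjoint_left]
      intro f hf hf'
      rw [mem_product] at hf hf'
      exact hne ((paths_apply hf.1 le_rfl).symm.trans (paths_apply hf'.1 le_rfl))
  have hmax : ∀ p : Equiv.Perm (Fin N), ∃ m < N, permVal p m = N - 1 := fun p =>
    exists_permVal_eq p (by omega)
  choose top htop hval using hmax
  let f (p : Equiv.Perm (Fin N)) : (ℕ → ℕ) × ℕ := (fun x => runMax (permVal p) (min x k), top p)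
  rw [← hQ, Nat.subtype_card (univ.filter fun p => Avoids321 p ∧ Winnable N k p) (by simp)]
  refine card_bij (fun p _ => f p) ?_ ?_ ?_
  · intro p hp
    obtain ⟨hkm, hrun⟩ := (winnable_iff p (htop p) (hval p)).1 (mem_filter.1 hp).2.2
    have hle := runMax_permVal_lt p (htop p) le_rfl (hval p)
    have hge := le_runMax_permVal p (htop p).le
    have hge' := le_runMax_permVal p hk.le
    simp only [Q, mem_biUnion, mem_product, mem_Ico, mem_Icc]
    refine ⟨runMax (permVal p) k, by omega, mem_paths.2 ⟨by simp [f, runMax],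
      fun x y hxy => runMax_mono _ (min_le_min_right k hxy), fun x hx => ?_, fun x hx => ?_⟩,
      hkm, by simp only [f]; omega⟩
    · simp only [f, min_eq_left hx]
      exact le_runMax_permVal p (by omega)
    · simp only [f, min_eq_right hx]
  · intro p hp q hq hpq
    rw [mem_filter] at hp hq
    obtain ⟨hkm, hrun⟩ := (winnable_iff p (htop p) (hval p)).1 hp.2.2
    obtain ⟨hkm', hrun'⟩ := (winnable_iff q (htop q) (hval q)).1 hq.2.2
    obtain ⟨hf, htop'⟩ := Prod.ext_iff.1 hpq
    simp only [f] at hf htop'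
    refine eq_of_runMax_eq hp.2.1 hq.2.1 fun x hx => ?_
    have hfx := congrFun hf x
    rcases le_or_gt x k with hxk | hxk
    · simpa [hxk] using hfx
    rw [min_eq_right hxk.le] at hfx
    rcases le_or_gt x (top p) with hxm | hxm
    · have h₁ := runMax_mono (permVal p) hxm
      have h₂ := runMax_mono (permVal p) hxk.le
      have h₃ := runMax_mono (permVal q) (hxm.trans htop'.le)
      have h₄ := runMax_mono (permVal q) hxk.le
      omega
    · rw [runMax_permVal_top p hx hxm (hval p), runMax_permVal_top q hx (htop' ▸ hxm) (hval q)]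
  · rintro ⟨h, m⟩ hb
    simp only [Q, mem_biUnion, mem_product, mem_Ico, mem_Icc] at hb
    obtain ⟨v, ⟨hkv, hvN⟩, hh, hkm, hmv⟩ := hb
    obtain ⟨h0, hmono, hle, hc⟩ := mem_paths.1 hh
    have hbound : ∀ x, h x ≤ v := fun x =>
      (hmono (le_max_left x k)).trans (hc _ (le_max_right x k)).le
    have hmono' : Monotone fun x => if x ≤ m then h x else N := fun x y hxy => by
      have h₁ := hmono hxy
      have h₂ := hbound x
      dsimp only
      split_ifs <;> omega
    have hle' : ∀ x ≤ N, x ≤ if x ≤ m then h x else N := fun x hx => by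
      split_ifs with hxm
      · rcases le_total x k with hxk | hxk
        · exact hle x hxk
        · rw [hc x hxk]
          omega
      · exact hx
    obtain ⟨p, hp, hrun⟩ := exists_perm_runMax_eq hmono' (by simpa using h0) hle'
      (if_neg (by omega))
    have htm : top p = m := by
      apply le_antisymm
      · by_contra! hlt
        have h₁ := runMax_permVal_lt p (htop p) hlt (hval p)
        rw [hrun _ (by omega), if_neg (by omega)] at h₁
        omega
      · by_contra! hlt
        have h₁ := runMax_permVal_top p (by omega) hlt (hval p)
        rw [hrun _ (by omega), if_pos le_rfl] at h₁
        have := hbound m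
        omega
    refine ⟨p, mem_filter.2 ⟨mem_univ p, hp, (winnable_iff p (htop p) (hval p)).2 ?_⟩, ?_⟩
    · rw [htm, hrun _ (by omega), hrun _ hk.le, if_pos le_rfl, if_pos hkm, hc m hkm, hc k le_rfl]
      exact ⟨hkm, rfl⟩
    · refine Prod.ext (funext fun x => ?_) htm
      simp only [f]
      rw [hrun _ (by omega), if_pos (by omega)]
      rcases le_total x k with hx | hx
      · rw [min_eq_left hx]
      · rw [min_eq_right hx, hc x hx, hc k le_rfl]

theorem S_eq_sum {i N k : ℕ} (hN : N = k + i) (hi : 0 < i) :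
    S i N = ∑ u ∈ range i, (paths k (k + u)).card * (u + 1) := by
  subst hN
  rw [S, Nat.add_sub_cancel, card_winnable (by omega), sum_Ico_eq_sum_range,
    Nat.add_sub_cancel_left]
  exact sum_congr rfl fun u _ => by rw [show k + u + 1 - k = u + 1 by omega]

theorem card_paths_eq (k : ℕ) :
    ((paths k k).card : ℤ) = catalan k ∧
    ((paths k (k + 1)).card : ℤ) = catalan (k + 1) - catalan k ∧
    ((paths k (k + 2)).card : ℤ) = catalan (k + 2) - 2 * catalan (k + 1) ∧
    ((paths k (k + 3)).card : ℤ) = catalan (k + 3) - 3 * catalan (k + 2) + catalan (k + 1) ∧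
    ((paths k (k + 4)).card : ℤ) =
      catalan (k + 4) - 4 * catalan (k + 3) + 3 * catalan (k + 2) := by
  have diag := fun k => card_paths_self k
  have first : ∀ k, ((paths k (k + 1)).card : ℤ) = catalan (k + 1) - catalan k := fun k => by
    have h₁ := card_paths_succ_self k
    rw [diag, diag] at h₁
    omega
  have second : ∀ k, ((paths k (k + 2)).card : ℤ) = catalan (k + 2) - 2 * catalan (k + 1) :=
    fun k => by
      have h₁ := card_paths_succ_succ k 0
      have h₂ := first (k + 1)
      have h₃ := diag (k + 1)
      simp only [add_zero, add_assoc, Nat.reduceAdd] at *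
      omega
  have third : ∀ k, ((paths k (k + 3)).card : ℤ) =
      catalan (k + 3) - 3 * catalan (k + 2) + catalan (k + 1) := fun k => by
    have h₁ := card_paths_succ_succ k 1
    have h₂ := first (k + 1)
    have h₃ := second (k + 1)
    simp only [add_assoc, Nat.reduceAdd] at *
    omega
  refine ⟨by rw [diag], first k, second k, third k, ?_⟩
  have h₁ := card_paths_succ_succ k 2
  have h₂ := second (k + 1)
  have h₃ := third (k + 1)
  simp only [add_assoc, Nat.reduceAdd] at *
  omega

/-- Closed formulas: `S_2(N) = 2C_{N-1} - C_{N-2}`,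
`S_3(N) = 3C_{N-1} - 4C_{N-2} - C_{N-3}`,
`S_4(N) = 4C_{N-1} - 9C_{N-2} - C_{N-4}`, and
`S_5(N) = 5C_{N-1} - 16C_{N-2} + 6C_{N-3} - C_{N-5}`. -/
theorem S_formulas (N : ℕ) (hN : 5 ≤ N) :
    (S 2 N : ℤ) = 2 * catalan (N - 1) - catalan (N - 2) ∧
    (S 3 N : ℤ) = 3 * catalan (N - 1) - 4 * catalan (N - 2) - catalan (N - 3) ∧
    (S 4 N : ℤ) = 4 * catalan (N - 1) - 9 * catalan (N - 2) - catalan (N - 4) ∧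
    (S 5 N : ℤ) =
      5 * catalan (N - 1) - 16 * catalan (N - 2) + 6 * catalan (N - 3) - catalan (N - 5) := by
  obtain ⟨n, rfl⟩ := Nat.exists_eq_add_of_le' hN
  obtain ⟨a₀, a₁, -⟩ := card_paths_eq (n + 3)
  obtain ⟨b₀, b₁, b₂, -⟩ := card_paths_eq (n + 2)
  obtain ⟨c₀, c₁, c₂, c₃, -⟩ := card_paths_eq (n + 1)
  obtain ⟨d₀, d₁, d₂, d₃, d₄⟩ := card_paths_eq n
  rw [S_eq_sum (k := n + 3) (i := 2) rfl (by norm_num),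
    S_eq_sum (k := n + 2) (i := 3) rfl (by norm_num),
    S_eq_sum (k := n + 1) (i := 4) rfl (by norm_num),
    S_eq_sum (k := n) (i := 5) rfl (by norm_num)]
  simp only [sum_range_succ, sum_range_zero, add_assoc, Nat.reduceAdd, Nat.reduceSubDiff,
    add_zero, zero_add, Nat.add_sub_cancel] at *
  push_cast
  refine ⟨?_, ?_, ?_, ?_⟩ <;> linarith
end

section
/- For all N ≥ 9 and all i > 3, S_3(N) > S_i(N); that is, among positional strategies on uniformly random 321-avoiding permutations of size N ≥ 9, the transition point k = N-3 strictly beats every k = N-i with i > 3. -/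
/-- Insert a new maximum value at position `j` of a permutation. -/
def insertMax {m : ℕ} (j : Fin (m + 1)) (q : Equiv.Perm (Fin m)) : Equiv.Perm (Fin (m + 1)) :=
  (finSuccEquiv' j).trans (q.optionCongr.trans (finSuccEquiv' (Fin.last m)).symm)

@[simp] lemma insertMax_self {m : ℕ} (j : Fin (m + 1)) (q : Equiv.Perm (Fin m)) :
    insertMax j q j = Fin.last m := by
  simp [insertMax]

@[simp] lemma insertMax_succAbove {m : ℕ} (j : Fin (m + 1)) (q : Equiv.Perm (Fin m)) (a : Fin m) :
    insertMax j q (j.succAbove a) = (q a).castSucc := by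
  simp [insertMax]

lemma insertMax_injective {m : ℕ} (j : Fin (m + 1)) : Function.Injective (insertMax j) := by
  intro q r h
  refine Equiv.ext fun a => ?_
  have := congrArg (fun p => p (j.succAbove a)) h
  simpa using this

lemma exists_insertMax_eq {m : ℕ} {j : Fin (m + 1)} {p : Equiv.Perm (Fin (m + 1))}
    (hp : p j = Fin.last m) : ∃ q, insertMax j q = p := by
  have hne : ∀ a, p (j.succAbove a) ≠ Fin.last m := fun a h =>
    Fin.succAbove_ne j a (p.injective (h.trans hp.symm))
  let f : Fin m → Fin m := fun a => (p (j.succAbove a)).castPred (hne a)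
  have hf : Function.Injective f := by
    intro a b h
    have h' : p (j.succAbove a) = p (j.succAbove b) := by simpa [f] using h
    exact Fin.succAbove_right_injective (p.injective h')
  refine ⟨Equiv.ofBijective f (Finite.injective_iff_bijective.mp hf), ?_⟩
  refine Equiv.ext fun b => ?_
  rcases Fin.eq_self_or_eq_succAbove j b with rfl | ⟨a, rfl⟩
  · simp [hp]
  · simp [f]

lemma card_insertMax {m : ℕ} (j : Fin (m + 1)) (P : Equiv.Perm (Fin (m + 1)) → Prop) :
    Nat.card {p // P p ∧ p j = Fin.last m} = Nat.card {q // P (insertMax j q)} := by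
  symm
  refine Nat.card_eq_of_bijective
    (fun q : {q // P (insertMax j q)} =>
      (⟨insertMax j q.1, q.2, insertMax_self j q.1⟩ : {p // P p ∧ p j = Fin.last m})) ⟨?_, ?_⟩
  · intro q r h
    exact Subtype.ext (insertMax_injective j (congrArg Subtype.val h))
  · rintro ⟨p, hP, hp⟩
    obtain ⟨q, rfl⟩ := exists_insertMax_eq hp
    exact ⟨⟨q, hP⟩, rfl⟩

lemma card_subtype_split {α : Type*} [Finite α] (P Q : α → Prop) :
    Nat.card {a // P a} = Nat.card {a // P a ∧ Q a} + Nat.card {a // P a ∧ ¬ Q a} := by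
  classical
  have := Fintype.ofFinite α
  simp only [Nat.card_eq_fintype_card, Fintype.card_subtype]
  rw [← Finset.card_filter_add_card_filter_not (s := Finset.univ.filter P) Q,
    Finset.filter_filter, Finset.filter_filter]

lemma succAbove_cases {m : ℕ} (j : Fin (m + 1)) (a : Fin m) :
    ((a : ℕ) < j ∧ (j.succAbove a : ℕ) = a) ∨ ((j : ℕ) ≤ a ∧ (j.succAbove a : ℕ) = a + 1) := by
  rcases lt_or_ge (a : ℕ) j with h | h
  · left
    rw [Fin.succAbove_of_castSucc_lt _ _ (by simpa [Fin.lt_def] using h)]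
    exact ⟨h, rfl⟩
  · right
    rw [Fin.succAbove_of_le_castSucc _ _ (by simpa [Fin.le_def] using h)]
    exact ⟨h, by simp⟩

lemma isLTRMax_of_eq_last {m : ℕ} {p : Equiv.Perm (Fin (m + 1))} {j : Fin (m + 1)}
    (hp : p j = Fin.last m) : IsLTRMax p j := fun a ha => by
  rw [hp]
  exact lt_of_le_of_ne (Fin.le_last _) fun h => ha.ne (p.injective (h.trans hp.symm))

lemma isLTRMax_insertMax_of_lt {m : ℕ} {j : Fin (m + 1)} (q : Equiv.Perm (Fin m)) {a : Fin m}
    (ha : (a : ℕ) < j) : IsLTRMax (insertMax j q) (j.succAbove a) ↔ IsLTRMax q a := by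
  constructor
  · intro h b hb
    have := h (j.succAbove b) (Fin.succAbove_lt_succAbove_iff.mpr hb)
    simpa using this
  · intro h b hb
    rcases Fin.eq_self_or_eq_succAbove j b with rfl | ⟨c, rfl⟩
    · rcases succAbove_cases b a with h' | h'
      · rw [Fin.lt_def] at hb; omega
      · omega
    · simpa using h c (Fin.succAbove_lt_succAbove_iff.mp hb)

lemma not_isLTRMax_of_gt {m : ℕ} {p : Equiv.Perm (Fin (m + 1))} {j b : Fin (m + 1)}
    (hp : p j = Fin.last m) (hb : j < b) : ¬ IsLTRMax p b := fun h => by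
  have := h j hb
  rw [hp] at this
  exact absurd this (not_lt.mpr (Fin.le_last _))

lemma avoids321_insertMax {m : ℕ} (j : Fin (m + 1)) (q : Equiv.Perm (Fin m)) :
    Avoids321 (insertMax j q) ↔
      Avoids321 q ∧ ∀ a b : Fin m, (j : ℕ) ≤ a → a < b → q a < q b := by
  constructor
  · intro h
    refine ⟨?_, ?_⟩
    · rintro ⟨a, b, c, hab, hbc, h1, h2⟩
      exact h ⟨j.succAbove a, j.succAbove b, j.succAbove c, Fin.succAbove_lt_succAbove_iff.mpr hab,
        Fin.succAbove_lt_succAbove_iff.mpr hbc, by simpa using h1, by simpa using h2⟩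
    · intro a b ha hab
      by_contra hlt
      have hne : q b ≠ q a := fun h => hab.ne (q.injective h).symm
      refine h ⟨j, j.succAbove a, j.succAbove b, ?_, Fin.succAbove_lt_succAbove_iff.mpr hab, ?_, ?_⟩
      · rw [Fin.lt_def]
        rcases succAbove_cases j a with h' | h' <;> omega
      · simpa using lt_of_le_of_ne (not_lt.mp hlt) hne
      · simp
  · rintro ⟨hq, hinc⟩ ⟨a, b, c, hab, hbc, h1, h2⟩
    rcases Fin.eq_self_or_eq_succAbove j b with rfl | ⟨b, rfl⟩
    · rw [insertMax_self] at h2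
      exact absurd h2 (not_lt.mpr (Fin.le_last _))
    rcases Fin.eq_self_or_eq_succAbove j c with rfl | ⟨c, rfl⟩
    · rw [insertMax_self] at h1
      exact absurd h1 (not_lt.mpr (Fin.le_last _))
    have hbc' := Fin.succAbove_lt_succAbove_iff.mp hbc
    have h1' : q c < q b := by simpa using h1
    rcases Fin.eq_self_or_eq_succAbove j a with rfl | ⟨a, rfl⟩
    · refine absurd (hinc b c ?_ hbc') (not_lt.mpr h1'.le)
      rw [Fin.lt_def] at hab
      rcases succAbove_cases a b with h' | h' <;> omega
    · exact hq ⟨a, b, c, Fin.succAbove_lt_succAbove_iff.mp hab, hbc', h1', by simpa using h2⟩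

/-- A 321-avoiding permutation with no left-to-right maximum in `[k, j)` and increasing from
position `j` on. -/
def TailGood (m k j : ℕ) (q : Equiv.Perm (Fin m)) : Prop :=
  Avoids321 q ∧ (∀ a : Fin m, k ≤ (a : ℕ) → (a : ℕ) < j → ¬ IsLTRMax q a) ∧
    ∀ a b : Fin m, j ≤ (a : ℕ) → a < b → q a < q b

/-- The number of permutations of size `m` satisfying `TailGood m k j`. -/
noncomputable def tailCount (m k j : ℕ) : ℕ := Nat.card {q // TailGood m k j q}

lemma tailGood_insertMax_last {m k j : ℕ} (hj : j ≤ m) (q : Equiv.Perm (Fin m)) :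
    TailGood (m + 1) k j (insertMax (Fin.last m) q) ↔ TailGood m k j q := by
  unfold TailGood
  rw [avoids321_insertMax]
  have hvac : ∀ a b : Fin m, ((Fin.last m : Fin (m + 1)) : ℕ) ≤ a → a < b → q a < q b :=
    fun a b h => absurd h (by have := a.2; simp)
  constructor
  · rintro ⟨⟨h1, -⟩, h2, h3⟩
    refine ⟨h1, fun a hk ha hl => ?_, fun a b ha hab => ?_⟩
    · refine h2 ((Fin.last m).succAbove a) (by simpa using hk) (by simpa using ha) ?_
      exact (isLTRMax_insertMax_of_lt q (by simp)).mpr hl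
    · have := h3 ((Fin.last m).succAbove a) ((Fin.last m).succAbove b) (by simpa using ha)
        (Fin.succAbove_lt_succAbove_iff.mpr hab)
      simpa only [insertMax_succAbove, Fin.castSucc_lt_castSucc_iff] using this
  · rintro ⟨h1, h2, h3⟩
    refine ⟨⟨h1, hvac⟩, fun a hk ha hl => ?_, fun a b ha hab => ?_⟩
    · rcases Fin.eq_self_or_eq_succAbove (Fin.last m) a with rfl | ⟨a, rfl⟩
      · simp at ha; omega
      · exact h2 a (by simpa using hk) (by simpa using ha)
          ((isLTRMax_insertMax_of_lt q (by simp)).mp hl)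
    · rcases Fin.eq_self_or_eq_succAbove (Fin.last m) a with rfl | ⟨a, rfl⟩
      · exact absurd hab (not_lt.mpr (Fin.le_last _))
      rcases Fin.eq_self_or_eq_succAbove (Fin.last m) b with rfl | ⟨b, rfl⟩
      · rw [insertMax_succAbove, insertMax_self]
        exact Fin.castSucc_lt_last _
      · rw [insertMax_succAbove, insertMax_succAbove, Fin.castSucc_lt_castSucc_iff]
        exact h3 a b (by simpa using ha) (Fin.succAbove_lt_succAbove_iff.mp hab)

lemma tailGood_and_ne_last_iff {m k j : ℕ} (hk : k ≤ j) (hj : j ≤ m)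
    (p : Equiv.Perm (Fin (m + 1))) :
    TailGood (m + 1) k j p ∧ ¬ p (Fin.last m) = Fin.last m ↔ TailGood (m + 1) k (m + 1) p := by
  constructor
  · rintro ⟨⟨h1, h2, h3⟩, h4⟩
    refine ⟨h1, fun a ha _ hl => ?_, fun a b ha => absurd ha (by omega)⟩
    by_cases haj : (a : ℕ) < j
    · exact h2 a ha haj hl
    · obtain ⟨c, hc⟩ := p.surjective (Fin.last m)
      have hcl : c ≠ Fin.last m := fun h => h4 (h ▸ hc)
      rcases lt_or_ge (c : ℕ) j with hcj | hcj
      · have := hl c (by rw [Fin.lt_def]; omega)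
        rw [hc] at this
        exact absurd this (not_lt.mpr (Fin.le_last _))
      · have := h3 c (Fin.last m) hcj (lt_of_le_of_ne (Fin.le_last _) hcl)
        rw [hc] at this
        exact absurd this (not_lt.mpr (Fin.le_last _))
  · rintro ⟨h1, h2, -⟩
    refine ⟨⟨h1, fun a ha _ => h2 a ha a.2, fun a b ha hab => ?_⟩, fun h => ?_⟩
    · have hna := h2 a (hk.trans ha) a.2
      unfold IsLTRMax at hna
      push Not at hna
      obtain ⟨c, hca, hc⟩ := hna
      by_contra hlt
      exact h1 ⟨c, a, b, hca, hab,
        lt_of_le_of_ne (not_lt.mp hlt) fun h => hab.ne (p.injective h).symm,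
        lt_of_le_of_ne hc fun h => hca.ne (p.injective h).symm⟩
    · exact h2 (Fin.last m) (by simp; omega) (by simp) (isLTRMax_of_eq_last h)

lemma tailCount_succ {m k j : ℕ} (hk : k ≤ j) (hj : j ≤ m) :
    tailCount (m + 1) k j = tailCount m k j + tailCount (m + 1) k (m + 1) := by
  unfold tailCount
  rw [card_subtype_split _ (fun p => p (Fin.last m) = Fin.last m), card_insertMax]
  congr 1
  · exact Nat.card_congr (Equiv.subtypeEquivRight fun q => tailGood_insertMax_last hj q)
  · exact Nat.card_congr (Equiv.subtypeEquivRight fun p => tailGood_and_ne_last_iff hk hj p)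

lemma tailCount_succ_succ {m k : ℕ} (hk : k ≤ m) :
    tailCount (m + 1) (k + 1) (m + 1) = tailCount (m + 1) k (m + 1) + tailCount m k k := by
  unfold tailCount
  let kk : Fin (m + 1) := ⟨k, by omega⟩
  rw [card_subtype_split _ (fun p => p kk = Fin.last m), card_insertMax, add_comm]
  congr 1
  · refine Nat.card_congr (Equiv.subtypeEquivRight fun p => ?_)
    constructor
    · rintro ⟨⟨h1, h2, h3⟩, h4⟩
      refine ⟨h1, fun a ha ha' hl => ?_, h3⟩
      obtain ⟨c, hc⟩ := p.surjective (Fin.last m)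
      rcases lt_trichotomy (c : ℕ) k with hck | hck | hck
      · exact not_isLTRMax_of_gt hc (by rw [Fin.lt_def]; omega) hl
      · exact h4 (by rw [← hc]; congr 1; exact Fin.ext hck.symm)
      · exact h2 c hck c.2 (isLTRMax_of_eq_last hc)
    · rintro ⟨h1, h2, h3⟩
      exact ⟨⟨h1, fun a ha => h2 a (by omega), h3⟩,
        fun h => h2 kk le_rfl kk.2 (isLTRMax_of_eq_last h)⟩
  · refine Nat.card_congr (Equiv.subtypeEquivRight fun q => ?_)
    unfold TailGood
    rw [avoids321_insertMax]
    constructor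
    · rintro ⟨⟨h1, h2⟩, -⟩
      exact ⟨h1, fun a _ _ => by omega, h2⟩
    · rintro ⟨h1, -, h2⟩
      exact ⟨⟨h1, h2⟩, fun a ha _ => not_isLTRMax_of_gt (insertMax_self kk q)
        (by rw [Fin.lt_def]; exact ha), fun a b ha => absurd ha (by omega)⟩

lemma tailCount_zero_right (m : ℕ) : tailCount (m + 1) 0 (m + 1) = 0 := by
  unfold tailCount
  rw [Nat.card_eq_zero]
  left
  refine ⟨fun ⟨q, _, h, _⟩ => h 0 (Nat.zero_le _) (by simp) fun a ha => ?_⟩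
  exact absurd ha (Fin.not_lt_zero a)

lemma tailCount_zero : tailCount 0 0 0 = 1 := by
  unfold tailCount
  rw [Nat.card_eq_one_iff_unique]
  exact ⟨inferInstance, ⟨1, fun ⟨a, _⟩ => a.elim0, fun a => a.elim0, fun a => a.elim0⟩⟩

lemma winnable_iff_s15 {m k : ℕ} {p : Equiv.Perm (Fin (m + 1))} {j : Fin (m + 1)}
    (hp : p j = Fin.last m) :
    Winnable (m + 1) k p ↔
      k ≤ (j : ℕ) ∧ ∀ a : Fin (m + 1), k ≤ (a : ℕ) → (a : ℕ) < j → ¬ IsLTRMax p a := by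
  constructor
  · rintro ⟨l, hl, -, hmin, hval⟩
    obtain rfl : l = j := p.injective (by rw [hp]; exact Fin.ext (by simpa using hval))
    exact ⟨hl, fun a ha hal h => absurd (hmin a ha h) (not_le.mpr hal)⟩
  · rintro ⟨hj, h⟩
    exact ⟨j, hj, isLTRMax_of_eq_last hp,
      fun a ha hl => not_lt.mp fun hlt => h a ha hlt hl, by simp [hp]⟩

lemma card_winnable_fiber {m k : ℕ} (j : Fin (m + 1)) :
    Nat.card {p : Equiv.Perm (Fin (m + 1)) //
      (Avoids321 p ∧ Winnable (m + 1) k p) ∧ p j = Fin.last m} =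
      if k ≤ (j : ℕ) then tailCount m k j else 0 := by
  rw [card_insertMax]
  split_ifs with hkj
  · refine Nat.card_congr (Equiv.subtypeEquivRight fun q => ?_)
    rw [winnable_iff_s15 (insertMax_self j q), avoids321_insertMax]
    unfold TailGood
    constructor
    · rintro ⟨⟨h1, h2⟩, -, h3⟩
      refine ⟨h1, fun a ha haj hl => ?_, h2⟩
      have hs : (j.succAbove a : ℕ) = a := by
        rcases succAbove_cases j a with h | h <;> omega
      exact h3 (j.succAbove a) (by omega) (by omega) ((isLTRMax_insertMax_of_lt q haj).mpr hl)
    · rintro ⟨h1, h2, h3⟩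
      refine ⟨⟨h1, h3⟩, hkj, fun a ha haj hl => ?_⟩
      rcases Fin.eq_self_or_eq_succAbove j a with rfl | ⟨a, rfl⟩
      · omega
      · rcases succAbove_cases j a with h | h
        · exact h2 a (by omega) h.1 ((isLTRMax_insertMax_of_lt q h.1).mp hl)
        · omega
  · rw [Nat.card_eq_zero]
    left
    exact ⟨fun ⟨q, _, hw⟩ => hkj ((winnable_iff_s15 (insertMax_self j q)).mp hw).1⟩

lemma S_eq_sum_s15 (i k : ℕ) :
    S (i + 1) (k + i + 1) = ∑ j ∈ Finset.range (i + 1), tailCount (k + i) k (k + j) := by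
  have hS : S (i + 1) (k + i + 1) = ∑ j : Fin (k + i + 1),
      if k ≤ (j : ℕ) then tailCount (k + i) k j else 0 := by
    unfold S
    rw [show k + i + 1 - (i + 1) = k by omega]
    rw [← Nat.card_congr (Equiv.sigmaFiberEquiv (fun p : {p : Equiv.Perm (Fin (k + i + 1)) //
      Avoids321 p ∧ Winnable (k + i + 1) k p} => p.1.symm (Fin.last (k + i)))), Nat.card_sigma]
    refine Finset.sum_congr rfl fun j _ => ?_
    rw [← card_winnable_fiber]
    refine Nat.card_congr ((Equiv.subtypeSubtypeEquivSubtypeInter _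
      (fun p : Equiv.Perm (Fin (k + i + 1)) => p.symm (Fin.last (k + i)) = j)).trans
      (Equiv.subtypeEquivRight fun p => ?_))
    rw [Equiv.symm_apply_eq, eq_comm (a := Fin.last (k + i))]
  rw [hS, ← Finset.sum_range (fun j => if k ≤ j then tailCount (k + i) k j else 0), add_assoc,
    Finset.sum_range_add, Finset.sum_eq_zero, zero_add]
  · simp
  · intro j hj
    rw [Finset.mem_range] at hj
    simp [hj]

lemma S_one (k : ℕ) : S 1 (k + 1) = tailCount k k k := by
  simpa using S_eq_sum_s15 0 k

lemma S_succ (i k : ℕ) :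
    S (i + 2) (k + i + 2) =
      S (i + 1) (k + i + 1) + (i + 2) * tailCount (k + i + 1) k (k + i + 1) := by
  have h := S_eq_sum_s15 (i + 1) k
  rw [show k + (i + 1) + 1 = k + i + 2 by ring, show i + 1 + 1 = i + 2 by ring,
    show k + (i + 1) = k + i + 1 by ring] at h
  rw [h, S_eq_sum_s15, Finset.sum_range_succ, show k + (i + 1) = k + i + 1 by ring,
    Finset.sum_congr rfl (g := fun j => tailCount (k + i) k (k + j) +
      tailCount (k + i + 1) k (k + i + 1)), Finset.sum_add_distrib]
  · simp; ring
  · intro j hj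
    rw [Finset.mem_range] at hj
    exact tailCount_succ (by omega) (by omega)

/-- The number of 321-avoiding permutations of size `k + d` increasing on the last `d` positions. -/
noncomputable def ballot (d k : ℕ) : ℕ := tailCount (k + d) k k

lemma tailCount_eq_ballot (d k : ℕ) :
    tailCount (k + d + 1) (k + 1) (k + d + 1) = ballot (d + 1) k := by
  rw [tailCount_succ_succ (by omega), ballot, ← add_assoc, tailCount_succ le_rfl (by omega),
    add_comm]

lemma ballot_zero_succ (k : ℕ) : ballot 0 (k + 1) = ballot 1 k :=
  tailCount_eq_ballot 0 k

lemma ballot_succ_succ (d k : ℕ) :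
    ballot (d + 1) (k + 1) = ballot d (k + 1) + ballot (d + 2) k := by
  rw [← tailCount_eq_ballot (d + 1) k, ballot, ballot, ← add_assoc,
    tailCount_succ le_rfl (by omega)]
  congr 2 <;> ring

lemma ballot_zero_right (d : ℕ) : ballot d 0 = 1 := by
  induction d with
  | zero => exact tailCount_zero
  | succ d ih =>
    rw [ballot, ← add_assoc, tailCount_succ le_rfl (by omega), Nat.zero_add,
      tailCount_zero_right, add_zero]
    simpa [ballot] using ih

lemma ballot_eq (d k : ℕ) :
    ballot d k + (d + 2 * k).choose (d + k + 1) = (d + 2 * k).choose k := by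
  induction k generalizing d with
  | zero => simp [ballot_zero_right]
  | succ k ih =>
    induction d with
    | zero =>
      rw [ballot_zero_succ]
      have h := ih 1
      have h1 := Nat.choose_succ_succ' (1 + 2 * k) k
      have h2 := Nat.choose_succ_succ' (1 + 2 * k) (k + 1)
      rw [show 0 + 2 * (k + 1) = 1 + 2 * k + 1 by ring, show 0 + (k + 1) + 1 = k + 1 + 1 by ring]
      rw [show 1 + k + 1 = k + 1 + 1 by ring] at h
      omega
    | succ d ihd =>
      rw [ballot_succ_succ]
      have h := ih (d + 2)
      have h1 := Nat.choose_succ_succ' (d + 2 + 2 * k) k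
      have h2 := Nat.choose_succ_succ' (d + 2 + 2 * k) (d + k + 2)
      rw [show d + 2 * (k + 1) = d + 2 + 2 * k by ring,
        show d + (k + 1) + 1 = d + k + 2 by ring] at ihd
      rw [show d + 1 + 2 * (k + 1) = d + 2 + 2 * k + 1 by ring,
        show d + 1 + (k + 1) + 1 = d + k + 2 + 1 by ring]
      rw [show d + 2 + k + 1 = d + k + 2 + 1 by ring] at h
      omega

lemma succ_mul_ballot_zero (k : ℕ) : (k + 1) * ballot 0 k = k.centralBinom := by
  have h := ballot_eq 0 k
  have h1 := Nat.choose_succ_right_eq (2 * k) k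
  rw [show 2 * k - k = k by omega] at h1
  simp only [zero_add] at h
  rw [Nat.centralBinom]
  nlinarith

lemma ballot_zero_succ_le (k : ℕ) : ballot 0 (k + 1) ≤ 4 * ballot 0 k := by
  have h := Nat.succ_mul_centralBinom_succ k
  rw [← succ_mul_ballot_zero, ← succ_mul_ballot_zero] at h
  have h' : (k + 2) * ballot 0 (k + 1) = 2 * (2 * k + 1) * ballot 0 k := by
    apply Nat.eq_of_mul_eq_mul_left (Nat.succ_pos k)
    rw [Nat.succ_eq_add_one]
    linear_combination h
  by_contra! hlt
  nlinarith

lemma ballot_pos (d k : ℕ) : 0 < ballot d k := by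
  induction k generalizing d with
  | zero => simp [ballot_zero_right]
  | succ k ih =>
    cases d with
    | zero => rw [ballot_zero_succ]; exact ih 1
    | succ d => rw [ballot_succ_succ]; exact Nat.add_pos_right _ (ih _)

lemma ballot_add_two_le (d k : ℕ) : ballot (d + 2) k ≤ 3 * ballot d (k + 1) := by
  induction k generalizing d with
  | zero =>
    have := ballot_pos d 1
    rw [ballot_zero_right, zero_add]
    omega
  | succ k ih =>
    induction d with
    | zero =>
      have h1 := ballot_zero_succ_le (k + 2)
      rw [ballot_zero_succ, ballot_succ_succ] at h1
      simp only [Nat.reduceAdd, zero_add, add_assoc] at h1 ⊢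
      omega
    | succ d ihd =>
      have h1 := ih (d + 2)
      have h2 := ballot_succ_succ (d + 2) k
      have h3 := ballot_succ_succ d (k + 1)
      rw [show d + 1 + 2 = d + 2 + 1 by ring]
      omega

lemma mul_tailCount_le {i : ℕ} (hi : 3 ≤ i) (k : ℕ) :
    (i + 2) * tailCount (k + i + 1) k (k + i + 1) ≤
      (i + 1) * tailCount (k + i + 1) (k + 1) (k + i + 1) := by
  cases k with
  | zero => rw [Nat.zero_add, tailCount_zero_right]; simp
  | succ k =>
    have h1 := tailCount_eq_ballot (i + 1) k
    rw [show k + (i + 1) + 1 = k + 1 + i + 1 by ring] at h1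
    rw [h1, tailCount_eq_ballot i (k + 1), ballot_succ_succ]
    have := ballot_add_two_le i k
    nlinarith

lemma mul_tailCount_le_four_mul (i k : ℕ) :
    (i + 4) * tailCount (k + i + 3) k (k + i + 3) ≤
      4 * tailCount (k + i + 3) (k + i) (k + i + 3) := by
  induction i generalizing k with
  | zero => simp
  | succ i ih =>
    have h := mul_tailCount_le (i := i + 3) (by omega) k
    have h' := ih (k + 1)
    rw [show k + (i + 1) + 3 = k + i + 4 by ring, show i + 1 + 4 = i + 5 by ring,
      show k + (i + 1) = k + i + 1 by ring]
    rw [show k + (i + 3) + 1 = k + i + 4 by ring, show i + 3 + 2 = i + 5 by ring,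
      show i + 3 + 1 = i + 4 by ring] at h
    rw [show k + 1 + i + 3 = k + i + 4 by ring, show k + 1 + i = k + i + 1 by ring] at h'
    exact h.trans h'

lemma S_two (k : ℕ) :
    S 2 (k + 2) = tailCount k k k + 2 * tailCount (k + 1) k (k + 1) := by
  rw [← S_one]; exact S_succ 0 k

lemma S_three (k : ℕ) :
    S 3 (k + 3) = S 2 (k + 2) + 3 * tailCount (k + 2) k (k + 2) := S_succ 1 k

lemma S_four (k : ℕ) :
    S 4 (k + 4) = S 3 (k + 3) + 4 * tailCount (k + 3) k (k + 3) := S_succ 2 k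

lemma S_four_lt (k : ℕ) : S 4 (k + 4) < S 3 (k + 4) := by
  have e0 := tailCount_eq_ballot 0 k
  have e1 := tailCount_eq_ballot 1 k
  have e2 := tailCount_eq_ballot 2 k
  rw [add_zero] at e0
  rw [show k + 4 = k + 1 + 3 by ring, S_three (k + 1), S_two, show k + 1 + 3 = k + 4 by ring,
    S_four, S_three, S_two, show k + 1 + 2 = k + 2 + 1 by ring, e0, e1, e2]
  cases k with
  | zero =>
    have h := tailCount_zero_right
    rw [zero_add, zero_add, h 0, h 1, h 2, tailCount_zero]
    simp [ballot_zero_right]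
  | succ k =>
    have f0 := tailCount_eq_ballot 0 k
    have f1 := tailCount_eq_ballot 1 k
    have f2 := tailCount_eq_ballot 2 k
    have f3 := tailCount_eq_ballot 3 k
    rw [add_zero] at f0
    rw [show k + 1 + 2 = k + 2 + 1 by ring,
      show k + 1 + 3 = k + 3 + 1 by ring, f0, f1, f2, f3]
    have a1 := ballot_succ_succ 0 k
    have a2 := ballot_succ_succ 1 k
    have a3 := ballot_succ_succ 2 k
    have b1 := ballot_succ_succ 0 (k + 1)
    have b2 := ballot_succ_succ 1 (k + 1)
    have c1 := ballot_succ_succ 0 (k + 2)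
    have z0 := ballot_zero_succ k
    have z1 := ballot_zero_succ (k + 1)
    have z2 := ballot_zero_succ (k + 2)
    have z3 := ballot_zero_succ (k + 3)
    have u3 := ballot_zero_succ_le (k + 3)
    have p0 := ballot_pos 0 (k + 1)
    simp only [Nat.reduceAdd, zero_add, add_assoc] at *
    omega

lemma S_add_four_lt (i k : ℕ) : S (i + 4) (k + i + 4) < S 3 (k + i + 4) := by
  induction i with
  | zero => exact S_four_lt k
  | succ i ih =>
    have h1 := S_succ (i + 3) k
    have h2 := mul_tailCount_le_four_mul (i + 1) k
    have h3 := S_four_lt (k + i + 1)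
    rw [S_four] at h3
    simp only [Nat.reduceAdd, add_assoc, add_comm, add_left_comm] at *
    omega

/-- For all `N ≥ 9` and all `i > 3`, the transition point `k = N - 3` strictly
beats `k = N - i`: `S_3(N) > S_i(N)`. -/
theorem S3_optimal_among_larger (N i : ℕ) (hN : 9 ≤ N) (hi : 3 < i) :
    S i N < S 3 N := by
  rcases le_or_gt i N with h | h
  · obtain ⟨a, rfl⟩ := Nat.exists_eq_add_of_le' hi
    obtain ⟨k, rfl⟩ := Nat.exists_eq_add_of_le' h
    exact S_add_four_lt a k
  · obtain ⟨a, rfl⟩ := Nat.exists_eq_add_of_le' (show 4 ≤ N by omega)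
    have : S i (a + 4) = S (a + 4) (a + 4) := by
      unfold S
      rw [Nat.sub_eq_zero_of_le h.le, Nat.sub_self]
    rw [this]
    simpa using S_add_four_lt a 0
end
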